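/- For all integers r and t with t ≥ 1, 5t − 1 ≤ r and 9r ≤ 52t − 13, every (r,t)-graph H satisfies τ(H) ≤ ⌈(3r − 1)/4⌉ + ⌈(9r − 44t + 13)/8⌉. -/

import Mathlib

/-- `E` is the edge set of an `r`-uniform `r`-partite hypergraph on vertex type `V`
with parts given by the fibres of `part`: each edge contains exactly one vertex
from each of the `r` parts. -/
def IsRPartite {V : Type} (r : ℕ) (part : V → Fin r) (E : Finset (Finset V)) : Prop :=
  ∀ e ∈ E, ∀ j : Fin r, (e.filter (fun v => part v = j)).card = 1

/-- The hypergraph with edge set `E` is `t`-intersecting. -/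
def IntersectingGe {V : Type} (t : ℕ) (E : Finset (Finset V)) : Prop :=
  ∀ e ∈ E, ∀ f ∈ E, t ≤ ((↑e ∩ ↑f : Set V)).ncard

/-- `C` is a vertex cover of the hypergraph with edge set `E`. -/
def IsCover {V : Type} (E : Finset (Finset V)) (C : Finset V) : Prop :=
  ∀ e ∈ E, ∃ v ∈ e, v ∈ C

/-- The cover number: the minimum size of a vertex cover. -/
noncomputable def coverNumber {V : Type} (E : Finset (Finset V)) : ℕ :=
  sInf {n | ∃ C : Finset V, IsCover E C ∧ C.card = n}

open Finset in
/-- The set of coordinates on which two functions agree. -/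
def agreeSet {ι V : Type} [Fintype ι] [DecidableEq V] (e f : ι → V) : Finset ι :=
  univ.filter (fun j => e j = f j)

theorem mem_agreeSet {ι V : Type} [Fintype ι] [DecidableEq V] {e f : ι → V} {j : ι} :
    j ∈ agreeSet e f ↔ e j = f j := by
  simp [agreeSet]

/-- A family of functions such that every set of at most `m` values is avoided by a member. -/
def Uncovered {ι V : Type} (m : ℕ) (F : Set (ι → V)) : Prop :=
  ∀ C : Finset V, C.card ≤ m → ∃ h ∈ F, ∀ j, h j ∉ C

section

variable {ι V : Type} [Fintype ι] [DecidableEq ι] [DecidableEq V] {m s : ℕ} {F : Set (ι → V)}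

theorem Uncovered.exists_agreeSet_subset (hN : Uncovered m F) (e : ι → V) (S : Finset ι)
    (hS : Fintype.card ι ≤ S.card + m) : ∃ g ∈ F, agreeSet e g ⊆ S := by
  obtain ⟨g, hg, h⟩ := hN (Sᶜ.image e) (by
    have h₁ := Finset.card_image_le (s := Sᶜ) (f := e)
    have h₂ := Finset.card_compl S
    omega)
  refine ⟨g, hg, fun j hj => ?_⟩
  by_contra hjS
  exact h j (Finset.mem_image.2 ⟨j, by simpa using hjS, mem_agreeSet.1 hj⟩)

/-- The cover consisting of `A ⊆ f ∩ g`. -/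
theorem Uncovered.two_edges_inter (hN : Uncovered m F)
    (hI : ∀ e ∈ F, ∀ f ∈ F, s ≤ (agreeSet e f).card) {f g : ι → V} (hf : f ∈ F) (hg : g ∈ F)
    {A : Finset ι} (hA : A ⊆ agreeSet f g) (hm : A.card ≤ m) :
    2 * s + 2 * A.card ≤ Fintype.card ι + (agreeSet f g).card := by
  obtain ⟨h, hh, hav⟩ := hN (A.image f) (Finset.card_image_le.trans hm)
  have hne : ∀ j ∈ A, h j ≠ f j := fun j hj he =>
    hav j (he ▸ Finset.mem_image_of_mem f hj)
  have h₁ := hI h hh f hf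
  have h₂ := hI h hh g hg
  have h₃ := Finset.card_union_add_card_inter (agreeSet h f) (agreeSet h g)
  have h₄ : (agreeSet h f ∪ agreeSet h g).card ≤ Aᶜ.card := by
    apply Finset.card_le_card
    intro j hj
    simp only [Finset.mem_union, mem_agreeSet, Finset.mem_compl] at hj ⊢
    intro hjA
    have := hne j hjA
    have := mem_agreeSet.1 (hA hjA)
    grind
  have h₅ : (agreeSet h f ∩ agreeSet h g).card ≤ (agreeSet f g \ A).card := by
    apply Finset.card_le_card
    intro j hj
    have := hne j
    simp only [Finset.mem_inter, mem_agreeSet, Finset.mem_sdiff] at hj ⊢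
    grind
  have h₆ := Finset.card_compl A
  have h₇ := Finset.card_sdiff_add_card_eq_card hA
  have h₈ := Finset.card_le_univ A
  omega

/-- The cover consisting of `f ∩ g` and of both vertices of `f ∪ g` in the parts indexed by `B`. -/
theorem Uncovered.two_edges_union (hN : Uncovered m F)
    (hI : ∀ e ∈ F, ∀ f ∈ F, s ≤ (agreeSet e f).card) {f g : ι → V} (hf : f ∈ F) (hg : g ∈ F)
    {B : Finset ι} (hB : Disjoint (agreeSet f g) B)
    (hm : (agreeSet f g).card + 2 * B.card ≤ m) :
    2 * s + (agreeSet f g).card + B.card ≤ Fintype.card ι := by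
  obtain ⟨h, hh, hav⟩ := hN ((agreeSet f g).image f ∪ (B.image f ∪ B.image g)) (by
    have h₁ := Finset.card_union_le ((agreeSet f g).image f) (B.image f ∪ B.image g)
    have h₂ := Finset.card_union_le (B.image f) (B.image g)
    have h₃ := Finset.card_image_le (s := agreeSet f g) (f := f)
    have h₄ := Finset.card_image_le (s := B) (f := f)
    have h₅ := Finset.card_image_le (s := B) (f := g)
    omega)
  simp only [Finset.mem_union, Finset.mem_image, mem_agreeSet, not_or, not_exists, not_and] at hav
  have h₁ := hI h hh f hf
  have h₂ := hI h hh g hg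
  have hd : Disjoint (agreeSet h f) (agreeSet h g) := by
    rw [Finset.disjoint_left]
    intro j hj hj'
    rw [mem_agreeSet] at hj hj'
    exact (hav j).1 j (hj.symm.trans hj') hj.symm
  have h₃ := Finset.card_union_of_disjoint hd
  have h₄ : (agreeSet h f ∪ agreeSet h g).card ≤ (agreeSet f g ∪ B)ᶜ.card := by
    apply Finset.card_le_card
    intro j hj
    have := (hav j).1 j
    have := (hav j).2.1 j
    have := (hav j).2.2 j
    simp only [Finset.mem_union, mem_agreeSet, Finset.mem_compl] at hj ⊢
    grind
  have h₅ := Finset.card_compl (agreeSet f g ∪ B)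
  have h₆ := Finset.card_union_of_disjoint hB
  have h₇ := Finset.card_le_univ (agreeSet f g ∪ B)
  omega

/-- The cover consisting of the vertices in at least two of the edges `e`, `f`, `g`, and of all
vertices of `e ∪ f ∪ g` in the parts indexed by `B₁ ∪ B₂`, where exactly two of the edges agree
on the parts in `B₁`, and no two of them agree on the parts in `B₂`. -/
theorem Uncovered.three_edges (hN : Uncovered m F)
    (hI : ∀ e ∈ F, ∀ f ∈ F, s ≤ (agreeSet e f).card) {e f g : ι → V}
    (he : e ∈ F) (hf : f ∈ F) (hg : g ∈ F) {B₁ B₂ : Finset ι}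
    (hB₁ : B₁ ⊆ (agreeSet e f ∪ agreeSet e g ∪ agreeSet f g) \ (agreeSet e f ∩ agreeSet e g))
    (hB₂ : Disjoint (agreeSet e f ∪ agreeSet e g ∪ agreeSet f g) B₂)
    (hm : (agreeSet e f).card + (agreeSet e g \ agreeSet e f).card
      + (agreeSet f g \ agreeSet e f).card + B₁.card + 3 * B₂.card ≤ m) :
    3 * s + (agreeSet e f ∩ agreeSet e g).card + B₁.card + B₂.card ≤ Fintype.card ι := by
  set o : ι → V := fun j => if e j = f j then g j else if e j = g j then f j else e j with ho
  obtain ⟨h, hh, hav⟩ := hN ((agreeSet e f).image e ∪ ((agreeSet e g \ agreeSet e f).image e ∪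
      ((agreeSet f g \ agreeSet e f).image f ∪ (B₁.image o ∪ (B₂.image e ∪
      (B₂.image f ∪ B₂.image g)))))) (by
    refine le_trans ?_ hm
    have key : ∀ (A : Finset ι) (φ : ι → V) (X : Finset V) (n : ℕ), X.card ≤ n →
        (A.image φ ∪ X).card ≤ A.card + n := fun A φ X n hX =>
      (Finset.card_union_le _ _).trans (add_le_add Finset.card_image_le hX)
    refine (key _ _ _ _ (key _ _ _ _ (key _ _ _ _ (key _ _ _ _ (key _ _ _ _ (key _ _ _ _
      Finset.card_image_le)))))).trans (le_of_eq (by ring)))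
  simp only [Finset.mem_union, Finset.mem_image, Finset.mem_sdiff, mem_agreeSet, not_or,
    not_exists, not_and] at hav
  have hloc : ∀ j, (e j = f j → h j ≠ e j) ∧ (e j = g j → h j ≠ e j) ∧
      (f j = g j → h j ≠ f j) ∧
      (j ∈ B₁ ∪ B₂ → h j ≠ e j ∧ h j ≠ f j ∧ h j ≠ g j) := by
    intro j
    obtain ⟨a₁, a₂, a₃, a₄, a₅, a₆, a₇⟩ := hav j
    have a₁ := a₁ j
    have a₂ := a₂ j
    have a₃ := a₃ j
    have a₄ := a₄ j
    have a₅ := a₅ j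
    have a₆ := a₆ j
    have a₇ := a₇ j
    have b := @hB₁ j
    simp only [Finset.mem_union, Finset.mem_inter, Finset.mem_sdiff, mem_agreeSet] at b
    simp only [ho] at a₄
    simp only [Finset.mem_union]
    grind
  have h₁ := hI h hh e he
  have h₂ := hI h hh f hf
  have h₃ := hI h hh g hg
  have hd : Disjoint (agreeSet h e) (agreeSet h f) := by
    rw [Finset.disjoint_left]
    intro j
    have := hloc j
    simp only [mem_agreeSet]
    grind
  have hd' : Disjoint (agreeSet h e ∪ agreeSet h f) (agreeSet h g) := by
    rw [Finset.disjoint_left]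
    intro j
    have := hloc j
    simp only [mem_agreeSet, Finset.mem_union]
    grind
  have h₄ := Finset.card_union_of_disjoint hd
  have h₅ := Finset.card_union_of_disjoint hd'
  have h₆ : (agreeSet h e ∪ agreeSet h f ∪ agreeSet h g).card ≤
      ((agreeSet e f ∩ agreeSet e g) ∪ (B₁ ∪ B₂))ᶜ.card := by
    apply Finset.card_le_card
    intro j
    have := hloc j
    simp only [Finset.mem_union, Finset.mem_inter, mem_agreeSet, Finset.mem_compl] at this ⊢
    grind
  have h₇ := Finset.card_compl ((agreeSet e f ∩ agreeSet e g) ∪ (B₁ ∪ B₂))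
  have h₈ := Finset.card_le_univ ((agreeSet e f ∩ agreeSet e g) ∪ (B₁ ∪ B₂))
  have hd₁ : Disjoint B₁ B₂ :=
    Finset.disjoint_of_subset_left (hB₁.trans Finset.sdiff_subset) hB₂
  have hd₂ : Disjoint (agreeSet e f ∩ agreeSet e g) (B₁ ∪ B₂) := by
    rw [Finset.disjoint_left]
    intro j
    have b := @hB₁ j
    have b' : j ∈ _ → j ∉ B₂ := fun hj => Finset.disjoint_left.1 hB₂ hj
    simp only [Finset.mem_union, Finset.mem_inter, Finset.mem_sdiff, mem_agreeSet] at b b' ⊢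
    grind
  have h₉ := Finset.card_union_of_disjoint hd₁
  have h₁₀ := Finset.card_union_of_disjoint hd₂
  omega

/-- If each set of at most `m` values is avoided by some member of a `t`-intersecting family, then
`m` is smaller than the bound on the cover number. -/
theorem Uncovered.lt_bound (hN : Uncovered m F) {t : ℕ} (ht : 1 ≤ t)
    (hr : 5 * t ≤ Fintype.card ι + 1)
    (hI : ∀ e ∈ F, ∀ f ∈ F, t ≤ (agreeSet e f).card) :
    8 * m + 44 * t < 15 * Fintype.card ι + 11 := by
  by_contra! hm
  set r := Fintype.card ι with hr_def
  obtain ⟨s, hs, e, he, f, hf, hef, hmin⟩ : ∃ s, t ≤ s ∧ ∃ e ∈ F, ∃ f ∈ F,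
      (agreeSet e f).card = s ∧ ∀ e ∈ F, ∀ f ∈ F, s ≤ (agreeSet e f).card := by
    have hex : ∃ n, ∃ e ∈ F, ∃ f ∈ F, (agreeSet e f).card = n := by
      obtain ⟨e, he, -⟩ := hN ∅ (by simp)
      exact ⟨_, e, he, e, he, rfl⟩
    classical
    obtain ⟨e, he, f, hf, h⟩ := Nat.find_spec hex
    exact ⟨Nat.find hex, h ▸ hI e he f hf, e, he, f, hf, h,
      fun e he f hf => Nat.find_min' hex ⟨e, he, f, hf, rfl⟩⟩
  have hsm : s + m ≤ r := by
    by_contra! hlt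
    rcases le_total r m with hrm | hrm
    · obtain ⟨g, hg, hsub⟩ := hN.exists_agreeSet_subset e ∅ (by simpa using hrm)
      have := hmin e he g hg
      have := Finset.card_le_card hsub
      simp only [Finset.card_empty] at this
      omega
    · obtain ⟨S, -, hS⟩ := Finset.exists_subset_card_eq (s := (Finset.univ : Finset ι))
        (n := r - m) (by rw [Finset.card_univ]; omega)
      obtain ⟨g, hg, hsub⟩ := hN.exists_agreeSet_subset e S (by omega)
      have := hmin e he g hg
      have := Finset.card_le_card hsub
      omega
  obtain ⟨d, hd⟩ := Nat.exists_eq_add_of_le hsm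
  obtain ⟨k, hk₁, hk₂, hk₃⟩ : ∃ k, d + 1 ≤ k ∧ 2 * r + 3 + d ≤ 10 * s + k ∧
      (k = d + 1 ∨ 2 * r + 3 + d = 10 * s + k) := by
    rcases le_total (2 * r + 3 + d) (10 * s + (d + 1)) with h | h
    · exact ⟨d + 1, le_rfl, h, Or.inl rfl⟩
    · exact ⟨2 * r + 3 + d - 10 * s, by omega, by omega, Or.inr (by omega)⟩
  have hks : k ≤ s := by rcases hk₃ with h | h <;> linarith
  have hdk : s + (d + k) ≤ r := by rcases hk₃ with h | h <;> linarith
  obtain ⟨l, hl⟩ := Nat.exists_eq_add_of_le hks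
  obtain ⟨S₁, hS₁, hS₁c⟩ := Finset.exists_subset_card_eq (s := agreeSet e f) (n := l)
    (by linarith)
  obtain ⟨S₂, hS₂, hS₂c⟩ := Finset.exists_subset_card_eq (s := (agreeSet e f)ᶜ) (n := d + k)
    (by rw [Finset.card_compl, ← hr_def, hef]; exact Nat.le_sub_of_add_le' hdk)
  obtain ⟨g, hg, hsub⟩ := hN.exists_agreeSet_subset e (S₁ ∪ S₂) (by
    rw [Finset.card_union_of_disjoint
      (Finset.disjoint_of_subset_left hS₁ (Finset.disjoint_of_subset_right hS₂
        disjoint_compl_right)), hS₁c, hS₂c]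
    linarith)
  have hx : (agreeSet e f ∩ agreeSet e g).card ≤ l := by
    rw [← hS₁c]
    apply Finset.card_le_card
    intro j hj
    have h₁ := @hsub j
    have h₂ := @hS₂ j
    simp only [Finset.mem_inter, Finset.mem_union, Finset.mem_compl] at hj h₁ h₂
    tauto
  have hu : (agreeSet e g \ agreeSet e f).card ≤ d + k := by
    rw [← hS₂c]
    apply Finset.card_le_card
    intro j hj
    have h₁ := @hsub j
    have h₂ := @hS₁ j
    simp only [Finset.mem_sdiff, Finset.mem_union] at hj h₁ h₂
    tauto
  have hxu : (agreeSet e g \ agreeSet e f).card + (agreeSet e f ∩ agreeSet e g).card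
      = (agreeSet e g).card := by
    rw [Finset.inter_comm]
    exact Finset.card_sdiff_add_card_inter _ _
  have hxv : (agreeSet f g \ agreeSet e f).card + (agreeSet e f ∩ agreeSet e g).card
      = (agreeSet f g).card := by
    rw [← Finset.card_sdiff_add_card_inter (agreeSet f g) (agreeSet e f)]
    congr 2
    ext j
    simp only [Finset.mem_inter, mem_agreeSet]
    grind
  have hU : (agreeSet e f ∪ agreeSet e g ∪ agreeSet f g).card = s
      + (agreeSet e g \ agreeSet e f).card + (agreeSet f g \ agreeSet e f).card := by
    rw [← hef, ← Finset.card_union_of_disjoint Finset.disjoint_sdiff,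
      ← Finset.card_union_of_disjoint]
    · congr 1
      ext j
      simp only [Finset.mem_union, Finset.mem_sdiff]
      tauto
    · rw [Finset.disjoint_left]
      intro j
      simp only [Finset.mem_union, Finset.mem_sdiff, mem_agreeSet]
      grind
  have hTU : agreeSet e f ∩ agreeSet e g ⊆ agreeSet e f ∪ agreeSet e g ∪ agreeSet f g := by
    intro j
    simp only [Finset.mem_union, Finset.mem_inter]
    tauto
  have hM := Finset.card_sdiff_add_card_eq_card hTU
  have hUr := Finset.card_le_univ (agreeSet e f ∪ agreeSet e g ∪ agreeSet f g)
  have hUc := Finset.card_add_card_compl (agreeSet e f ∪ agreeSet e g ∪ agreeSet f g)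
  have heg := hmin e he g hg
  have hfg := hmin f hf g hg
  have hthree := @Uncovered.three_edges _ _ _ _ _ m s F hN hmin e f g he hf hg
  have htwo := @Uncovered.two_edges_union _ _ _ _ _ m s F hN hmin f g hf hg
  have hinter := @Uncovered.two_edges_inter _ _ _ _ _ m s F hN hmin f g hf hg
  have hfgc := Finset.card_add_card_compl (agreeSet f g)
  rw [← hr_def] at hUr hUc hfgc hthree htwo hinter
  rw [hef] at hthree
  rw [hU] at hM hUr hUc
  generalize (agreeSet e f ∩ agreeSet e g).card = x at *
  generalize (agreeSet e g \ agreeSet e f).card = u at *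
  generalize (agreeSet f g \ agreeSet e f).card = v at *
  have hxs : x + k ≤ s := by linarith
  have hy : v + x + 3 * s ≤ r + 1 + d := by
    by_contra! hy
    rw [hxv] at hy
    rcases le_or_gt ((agreeSet f g).card + 2 * s) (r + 1) with hle | hgt
    · obtain ⟨b, hb⟩ := Nat.exists_eq_add_of_le hle
      obtain ⟨B, hB, hBc⟩ := Finset.exists_subset_card_eq (s := (agreeSet f g)ᶜ)
        (n := b) (by linarith)
      have := htwo (B := B) (Finset.disjoint_of_subset_right hB disjoint_compl_right)
        (by rw [hBc]; linarith)
      linarith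
    · rcases le_total (agreeSet f g).card m with hle' | hge
      · have := hinter (A := agreeSet f g) subset_rfl hle'
        linarith
      · obtain ⟨A, hA, hAc⟩ := Finset.exists_subset_card_eq hge
        have := hinter hA hAc.le
        rw [hAc] at this
        linarith
  obtain ⟨j, hj⟩ : ∃ j, r + 1 = 3 * s + x + j := Nat.exists_eq_add_of_le (by linarith)
  rcases le_total j ((agreeSet e f ∪ agreeSet e g ∪ agreeSet f g) \
    (agreeSet e f ∩ agreeSet e g)).card with hjle | hjge
  · obtain ⟨B, hB, hBc⟩ := Finset.exists_subset_card_eq hjle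
    have := hthree (B₁ := B) (B₂ := ∅) hB (by simp) (by
      rw [Finset.card_empty, hBc]
      rcases hk₃ with h | h <;> linarith)
    rw [Finset.card_empty, hBc] at this
    linarith
  · obtain ⟨q, hq⟩ := Nat.exists_eq_add_of_le hjge
    obtain ⟨B, hB, hBc⟩ := Finset.exists_subset_card_eq
      (s := (agreeSet e f ∪ agreeSet e g ∪ agreeSet f g)ᶜ) (n := q) (by linarith)
    have := hthree subset_rfl
      (Finset.disjoint_of_subset_right hB disjoint_compl_right) (by rw [hBc]; linarith)
    rw [hBc] at this
    linarith

end

/-- The transversal functions whose values lie in a common edge. -/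
def edgeFunctions {V : Type} {r : ℕ} (part : V → Fin r) (E : Finset (Finset V)) :
    Set (Fin r → V) :=
  {φ | ∃ e ∈ E, ∀ j, φ j ∈ e ∧ part (φ j) = j}

theorem IntersectingGe.le_card_agreeSet {V : Type} [DecidableEq V] {r t : ℕ}
    {part : V → Fin r} {E : Finset (Finset V)} (hI : IntersectingGe t E)
    (hP : IsRPartite r part E) :
    ∀ φ ∈ edgeFunctions part E, ∀ ψ ∈ edgeFunctions part E, t ≤ (agreeSet φ ψ).card := by
  rintro φ ⟨e, he, hφ⟩ ψ ⟨f, hf, hψ⟩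
  have huniq : ∀ e ∈ E, ∀ v ∈ e, ∀ w ∈ e, part v = part w → v = w := by
    intro e he v hv w hw h
    exact Finset.card_le_one.1 (hP e he (part w)).le v (by simp [hv, h]) w (by simp [hw])
  refine (hI e he f hf).trans ?_
  rw [← Finset.coe_inter, Set.ncard_coe_finset]
  refine (Finset.card_le_card (t := (agreeSet φ ψ).image φ) ?_).trans Finset.card_image_le
  intro v hv
  rw [Finset.mem_inter] at hv
  have h₁ : φ (part v) = v := huniq e he _ (hφ _).1 _ hv.1 (hφ _).2
  have h₂ : ψ (part v) = v := huniq f hf _ (hψ _).1 _ hv.2 (hψ _).2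
  exact Finset.mem_image.2 ⟨part v, mem_agreeSet.2 (h₁.trans h₂.symm), h₁⟩

theorem IsRPartite.uncovered {V : Type} {r m : ℕ} {part : V → Fin r} {E : Finset (Finset V)}
    (hP : IsRPartite r part E) (hm : m < coverNumber E) :
    Uncovered m (edgeFunctions part E) := by
  intro C hC
  by_contra! h
  have hcov : IsCover E C := by
    intro e he
    have hex : ∀ j : Fin r, ∃ v, v ∈ e ∧ part v = j := by
      intro j
      obtain ⟨v, hv⟩ := Finset.card_pos.1 (by rw [hP e he j]; exact one_pos)
      exact ⟨v, Finset.mem_filter.1 hv⟩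
    choose φ hφ using hex
    obtain ⟨j, hj⟩ := h φ ⟨e, he, hφ⟩
    exact ⟨φ j, (hφ j).1, hj⟩
  have : coverNumber E ≤ C.card := Nat.sInf_le ⟨C, hcov, rfl⟩
  omega

/-- **Second case of Proposition 2.7**: for `t ≥ 1`, `5t - 1 ≤ r` and
`9r ≤ 52t - 13`, every `(r,t)`-graph `H` satisfies
`τ(H) ≤ ⌈(3r - 1)/4⌉ + ⌈(9r - 44t + 13)/8⌉`. -/
theorem cover_le_ceil_bound_second {V : Type} [Fintype V] (r t : ℕ)
    (ht : 1 ≤ t) (hr : 5 * (t : ℤ) - 1 ≤ (r : ℤ)) (hr' : 9 * (r : ℤ) ≤ 52 * (t : ℤ) - 13)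
    (part : V → Fin r) (E : Finset (Finset V))
    (hP : IsRPartite r part E) (hI : IntersectingGe t E) :
    (coverNumber E : ℤ) ≤ ⌈(3 * (r : ℚ) - 1) / 4⌉
      + ⌈(9 * (r : ℚ) - 44 * (t : ℚ) + 13) / 8⌉ := by
  classical
  have h₁ := Int.le_ceil ((3 * (r : ℚ) - 1) / 4)
  have h₂ := Int.le_ceil ((9 * (r : ℚ) - 44 * (t : ℚ) + 13) / 8)
  generalize ⌈(3 * (r : ℚ) - 1) / 4⌉ = a at h₁ ⊢
  generalize ⌈(9 * (r : ℚ) - 44 * (t : ℚ) + 13) / 8⌉ = b at h₂ ⊢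
  rw [div_le_iff₀ (by norm_num)] at h₁ h₂
  have h₁' : 3 * (r : ℤ) - 1 ≤ a * 4 := by exact_mod_cast h₁
  have h₂' : 9 * (r : ℤ) - 44 * (t : ℤ) + 13 ≤ b * 8 := by exact_mod_cast h₂
  by_contra! hlt
  have hN := hP.uncovered (m := (a + b).toNat) (by omega)
  have := hN.lt_bound ht (by rw [Fintype.card_fin]; omega) (hI.le_card_agreeSet hP)
  rw [Fintype.card_fin] at this
  omega
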